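/- arXiv:1610.07471 — 4 statements merged into one kernel-verified Lean document; each statement's English description precedes it below -/
import Mathlib

section
/- Let b > 1 be an integer with smallest prime factor p. Then b/p ≤ s(b) ≤ b·Ω(b)/p; equivalently, b ≤ p·s(b) and p·s(b) ≤ b·Ω(b). -/
/-- The sum of all positive divisors of `n`. -/
def sigma (n : ℕ) : ℕ := ∑ d ∈ n.divisors, d

/-- The sum of the proper divisors of `n`. -/
def s (n : ℕ) : ℕ := sigma n - n

/-- The number of prime factors of `n` counted with multiplicity. -/
def bigOmega (n : ℕ) : ℕ := n.primeFactorsList.length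

lemma sigma_mul_of_coprime {m n : ℕ} (h : m.Coprime n) : sigma (m * n) = sigma m * sigma n := by
  simp only [sigma, ← ArithmeticFunction.sigma_one_apply]
  exact ArithmeticFunction.isMultiplicative_sigma.map_mul_of_coprime h

lemma sigma_prime_pow {q : ℕ} (hq : q.Prime) (a : ℕ) :
    sigma (q ^ a) = ∑ i ∈ Finset.range (a + 1), q ^ i := by
  simp [sigma, Nat.sum_divisors_prime_pow hq]

lemma sigma_one_eq_one : sigma 1 = 1 := by simp [sigma]

lemma bigOmega_one : bigOmega 1 = 0 := by simp [bigOmega]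

lemma bigOmega_mul {m n : ℕ} (hm : m ≠ 0) (hn : n ≠ 0) :
    bigOmega (m * n) = bigOmega m + bigOmega n := by
  simp [bigOmega, (Nat.perm_primeFactorsList_mul hm hn).length_eq]

lemma bigOmega_prime_pow {q : ℕ} (hq : q.Prime) (a : ℕ) : bigOmega (q ^ a) = a := by
  simp [bigOmega, hq.primeFactorsList_pow]

/-- Split off from `n` the full power of `q` if `q` is prime, and nothing otherwise. -/
lemma exists_eq_pow_mul_sigma_bigOmega (q : ℕ) {n : ℕ} (hn : n ≠ 0) :
    ∃ a m, m ≠ 0 ∧ n = q ^ a * m ∧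
      sigma n = (∑ i ∈ Finset.range (a + 1), q ^ i) * sigma m ∧
      bigOmega n = a + bigOmega m ∧ ∀ r, r.Prime → r ∣ m → r ∣ n ∧ r ≠ q := by
  by_cases hq : q.Prime
  · obtain ⟨a, m, hqm, rfl⟩ := Nat.exists_eq_pow_mul_and_not_dvd hn q hq.ne_one
    have hm : m ≠ 0 := by
      rintro rfl
      exact hqm (dvd_zero q)
    refine ⟨a, m, hm, rfl, ?_, ?_, ?_⟩
    · rw [sigma_mul_of_coprime (((Nat.Prime.coprime_iff_not_dvd hq).2 hqm).pow_left a),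
        sigma_prime_pow hq]
    · rw [bigOmega_mul (pow_ne_zero a hq.ne_zero) hm, bigOmega_prime_pow hq]
    · intro r _ hrm
      refine ⟨hrm.mul_left _, ?_⟩
      rintro rfl
      exact hqm hrm
  · refine ⟨0, n, hn, by simp, by simp, by simp, ?_⟩
    intro r hr hrn
    refine ⟨hrn, ?_⟩
    rintro rfl
    exact hq hr

lemma eq_one_of_forall_prime_not_dvd {n : ℕ} (h : ∀ r, r.Prime → ¬ r ∣ n) : n = 1 := by
  by_contra hn
  obtain ⟨r, hr, hrn⟩ := Nat.exists_prime_and_dvd hn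
  exact h r hr hrn

lemma geom_sum_mul_le (q a : ℕ) :
    q * ∑ i ∈ Finset.range a, q ^ i ≤ a * q ^ a := by
  rcases Nat.eq_zero_or_pos q with rfl | hq
  · simp
  rw [Finset.mul_sum]
  calc ∑ i ∈ Finset.range a, q * q ^ i ≤ ∑ _i ∈ Finset.range a, q ^ a := by
        refine Finset.sum_le_sum fun i hi => ?_
        rw [← pow_succ']
        exact Nat.pow_le_pow_right hq (Finset.mem_range.1 hi)
    _ = a * q ^ a := by simp

lemma pred_mul_geom_sum_le (k a : ℕ) :
    k * ∑ i ∈ Finset.range (a + 1), (k + 1) ^ i ≤ (k + 1) * (k + 1) ^ a := by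
  induction a with
  | zero => simp
  | succ a ih =>
    rw [Finset.sum_range_succ, mul_add]
    calc _ ≤ (k + 1) * (k + 1) ^ a + k * (k + 1) ^ (a + 1) := by gcongr
      _ = _ := by ring

lemma mul_geom_sum_le_add_two_mul {q : ℕ} (hq : 2 ≤ q) (a : ℕ) :
    q * ∑ i ∈ Finset.range (a + 1), q ^ i ≤ (q + 2) * q ^ a := by
  obtain ⟨k, rfl⟩ : ∃ k, q = k + 1 := ⟨q - 1, by omega⟩
  have h := pred_mul_geom_sum_le k a
  have hk : 0 < k := by omega
  refine le_of_mul_le_mul_left ?_ hk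
  calc k * ((k + 1) * ∑ i ∈ Finset.range (a + 1), (k + 1) ^ i)
      = (k + 1) * (k * ∑ i ∈ Finset.range (a + 1), (k + 1) ^ i) := by ring
    _ ≤ (k + 1) * ((k + 1) * (k + 1) ^ a) := by gcongr
    _ = ((k + 1) * (k + 1)) * (k + 1) ^ a := by ring
    _ ≤ (k * (k + 1 + 2)) * (k + 1) ^ a :=
        Nat.mul_le_mul_right _ (by nlinarith)
    _ = _ := by ring

/-- Every positive integer `n` with all prime factors in `[p, q)` satisfies both
`p σ(n) ≤ q n` and `p σ(n) ≤ n (p + Ω(n))`. -/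
def SigmaBounds (p q : ℕ) : Prop :=
  ∀ n, n ≠ 0 → (∀ r, r.Prime → r ∣ n → p ≤ r ∧ r < q) →
    p * sigma n ≤ q * n ∧ p * sigma n ≤ n * (p + bigOmega n)

lemma SigmaBounds.self (p : ℕ) : SigmaBounds p p := by
  intro n _ h
  obtain rfl : n = 1 := eq_one_of_forall_prime_not_dvd fun r hr hrn => by
    have := h r hr hrn
    omega
  simp [sigma_one_eq_one]

lemma SigmaBounds.add_two {p q : ℕ} (hodd : Odd q) (hq : 3 ≤ q) (h : SigmaBounds p q) :
    SigmaBounds p (q + 2) := by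
  intro n hn hr
  obtain ⟨a, m, hm, hnm, hσ, hΩ, hrm⟩ := exists_eq_pow_mul_sigma_bigOmega q hn
  obtain ⟨h₁, h₂⟩ := h m hm fun r hrp hrd => by
    obtain ⟨hrn, hne⟩ := hrm r hrp hrd
    obtain ⟨hpr, hlt⟩ := hr r hrp hrn
    refine ⟨hpr, ?_⟩
    have : r ≠ q + 1 := by
      rintro rfl
      rcases hrp.eq_two_or_odd' with h2 | h2
      · omega
      · rcases hodd with ⟨x, rfl⟩
        rcases h2 with ⟨y, hy⟩
        omega
    omega
  rw [hσ, hΩ, hnm]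
  constructor
  · calc p * ((∑ i ∈ Finset.range (a + 1), q ^ i) * sigma m)
        = (∑ i ∈ Finset.range (a + 1), q ^ i) * (p * sigma m) := by ring
      _ ≤ (∑ i ∈ Finset.range (a + 1), q ^ i) * (q * m) := by gcongr
      _ = (q * ∑ i ∈ Finset.range (a + 1), q ^ i) * m := by ring
      _ ≤ ((q + 2) * q ^ a) * m := by
          have := mul_geom_sum_le_add_two_mul (q := q) (by omega) a
          gcongr
      _ = _ := by ring
  · rw [Finset.sum_range_succ]
    calc p * ((∑ i ∈ Finset.range a, q ^ i + q ^ a) * sigma m)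
        = (∑ i ∈ Finset.range a, q ^ i) * (p * sigma m) + q ^ a * (p * sigma m) := by ring
      _ ≤ (∑ i ∈ Finset.range a, q ^ i) * (q * m) + q ^ a * (m * (p + bigOmega m)) := by gcongr
      _ = (q * ∑ i ∈ Finset.range a, q ^ i) * m + q ^ a * (m * (p + bigOmega m)) := by ring
      _ ≤ (a * q ^ a) * m + q ^ a * (m * (p + bigOmega m)) := by
          have := Nat.mul_le_mul_right m (geom_sum_mul_le q a)
          gcongr
      _ = _ := by ring

lemma SigmaBounds.add_two_mul {p q : ℕ} (hodd : Odd q) (hq : 3 ≤ q) (h : SigmaBounds p q)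
    (k : ℕ) : SigmaBounds p (q + 2 * k) := by
  induction k with
  | zero => exact h
  | succ k ih => exact ih.add_two (hodd.add_even (even_two_mul k)) (hq.trans (Nat.le_add_right _ _))

lemma two_mul_sigma_smooth_le_of_le_six :
    ∀ a < 7, ∀ b < 7 - a, ∀ c < 7 - a - b, ∀ d < 7 - a - b - c,
      2 * ((∑ i ∈ Finset.range (d + 1), 7 ^ i) * ((∑ i ∈ Finset.range (c + 1), 5 ^ i) *
        ((∑ i ∈ Finset.range (b + 1), 3 ^ i) * (∑ i ∈ Finset.range (a + 1), 2 ^ i)))) ≤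
      (7 ^ d * (5 ^ c * (3 ^ b * 2 ^ a))) * (2 + (d + (c + (b + a)))) := by
  decide

lemma sigmaBounds_two_nine : SigmaBounds 2 9 := by
  intro n hn hr
  obtain ⟨d, n₇, hn₇, hd, hσd, hΩd, hrd⟩ := exists_eq_pow_mul_sigma_bigOmega 7 hn
  obtain ⟨c, n₅, hn₅, hc, hσc, hΩc, hrc⟩ := exists_eq_pow_mul_sigma_bigOmega 5 hn₇
  obtain ⟨b, n₃, hn₃, hb, hσb, hΩb, hrb⟩ := exists_eq_pow_mul_sigma_bigOmega 3 hn₅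
  obtain ⟨a, m, -, ha, hσa, hΩa, hra⟩ := exists_eq_pow_mul_sigma_bigOmega 2 hn₃
  obtain rfl : m = 1 := eq_one_of_forall_prime_not_dvd fun r hrp hrm => by
    obtain ⟨h, h2⟩ := hra r hrp hrm
    obtain ⟨h, h3⟩ := hrb r hrp h
    obtain ⟨h, h5⟩ := hrc r hrp h
    obtain ⟨h, h7⟩ := hrd r hrp h
    obtain ⟨hlow, hup⟩ := hr r hrp h
    interval_cases r <;> first | omega | exact absurd hrp (by norm_num)
  rw [sigma_one_eq_one, mul_one] at hσa
  rw [bigOmega_one, add_zero] at hΩa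
  rw [mul_one] at ha
  rw [hσc, hσb, hσa] at hσd
  rw [hΩc, hΩb, hΩa] at hΩd
  rw [hc, hb, ha] at hd
  have h8 : 8 * sigma n ≤ 35 * n := by
    have h₂ := pred_mul_geom_sum_le 1 a
    have h₃ := pred_mul_geom_sum_le 2 b
    have h₅ := pred_mul_geom_sum_le 4 c
    have h₇ := pred_mul_geom_sum_le 6 d
    have h := Nat.mul_le_mul h₇ (Nat.mul_le_mul h₅ (Nat.mul_le_mul h₃ h₂))
    norm_num only at h
    rw [hσd, hd]
    linarith
  refine ⟨by omega, ?_⟩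
  by_cases hΩ : bigOmega n ≤ 6
  · rw [hσd, hΩd, hd]
    exact two_mul_sigma_smooth_le_of_le_six a (by omega) b (by omega) c (by omega) d (by omega)
  · have : n * 9 ≤ n * (2 + bigOmega n) := Nat.mul_le_mul_left n (by omega)
    omega

lemma Nat.Prime.mul_sigma_le {p n : ℕ} (hp : p.Prime) (hn : n ≠ 0)
    (h : ∀ r, r.Prime → r ∣ n → p ≤ r) : p * sigma n ≤ n * (p + bigOmega n) := by
  have hlt : ∀ r, r ∣ n → r ≤ n := fun r => Nat.le_of_dvd (Nat.pos_of_ne_zero hn)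
  rcases hp.eq_two_or_odd' with rfl | hodd
  · refine (sigmaBounds_two_nine.add_two_mul (by decide) (by norm_num) n n hn ?_).2
    intro r hr hrn
    have := hlt r hrn
    exact ⟨h r hr hrn, by omega⟩
  · have hp3 : 3 ≤ p := by
      rcases hodd with ⟨k, rfl⟩
      have := hp.two_le
      omega
    refine ((SigmaBounds.self p).add_two_mul hodd hp3 n n hn ?_).2
    intro r hr hrn
    have := hlt r hrn
    exact ⟨h r hr hrn, by omega⟩

lemma s_eq_sum_properDivisors (n : ℕ) : s n = ∑ d ∈ n.properDivisors, d := by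
  rw [s, sigma, Nat.sum_divisors_eq_sum_properDivisors_add_self, Nat.add_sub_cancel]

theorem s_bounds_via_minFac (b : ℕ) (hb : 1 < b) :
    b ≤ b.minFac * s b ∧ b.minFac * s b ≤ b * bigOmega b := by
  have hp : b.minFac.Prime := Nat.minFac_prime (by omega)
  constructor
  · have hmem : b / b.minFac ∈ b.properDivisors :=
      Nat.mem_properDivisors.2 ⟨Nat.div_dvd_of_dvd b.minFac_dvd,
        Nat.div_lt_self (by omega) hp.one_lt⟩
    have hle : b / b.minFac ≤ s b := by
      rw [s_eq_sum_properDivisors]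
      exact Finset.single_le_sum (f := fun d => d) (fun _ _ => Nat.zero_le _) hmem
    calc b = b.minFac * (b / b.minFac) := (Nat.mul_div_cancel' b.minFac_dvd).symm
      _ ≤ b.minFac * s b := Nat.mul_le_mul_left _ hle
  · have h := hp.mul_sigma_le (n := b) (by omega) fun r hr hrb => Nat.minFac_le_of_dvd hr.two_le hrb
    rw [s, Nat.mul_sub, Nat.sub_le_iff_le_add]
    linarith
end

section
/- For every real ε > 0 there exists a constant C > 0 such that for every even positive integer n, the set s⁻¹({n}) = {m ∈ ℕ : m ≥ 1 and s(m) = n} is finite and its cardinality is at most C·n^{1/2+ε}. -/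
open Finset

/-! ### Elementary facts about `sigma` -/

theorem sigma_eq_sum_properDivisors_add (n : ℕ) :
    sigma n = ∑ d ∈ n.properDivisors, d + n :=
  Nat.sum_divisors_eq_sum_properDivisors_add_self

theorem self_le_sigma (n : ℕ) : n ≤ sigma n := by
  rw [sigma_eq_sum_properDivisors_add]
  exact Nat.le_add_left n _

theorem sigma_mul_of_coprime_s8 {a b : ℕ} (h : a.Coprime b) :
    sigma (a * b) = sigma a * sigma b :=
  h.sum_divisors_mul

theorem sigma_le_card_divisors_mul (n : ℕ) : sigma n ≤ #n.divisors * n := by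
  simpa [sigma] using sum_le_card_nsmul n.divisors (fun d => d) n fun _ => Nat.divisor_le

theorem add_le_sigma_of_mem_properDivisors {n d : ℕ} (h : d ∈ n.properDivisors) :
    d + n ≤ sigma n := by
  rw [sigma_eq_sum_properDivisors_add]
  gcongr
  exact single_le_sum (f := fun d => d) (fun _ _ => Nat.zero_le _) h

theorem s_eq_iff {m n : ℕ} : s m = n ↔ sigma m = m + n := by
  have := self_le_sigma m
  unfold s
  lia

/-- If all prime factors of `n` are at least `p`, then the proper divisors of `n` are at most
`n / p`, so `sigma n` is close to `n`. -/
theorem mul_sigma_le {n p : ℕ} (hp : ∀ q, q.Prime → q ∣ n → p ≤ q) :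
    p * sigma n ≤ p * n + #n.divisors * n := by
  rw [sigma_eq_sum_properDivisors_add, mul_add, add_comm, mul_sum]
  gcongr
  calc ∑ d ∈ n.properDivisors, p * d ≤ ∑ _d ∈ n.properDivisors, n := by
        refine sum_le_sum fun d hd => ?_
        obtain ⟨⟨c, rfl⟩, hlt⟩ := Nat.mem_properDivisors.1 hd
        have hc : c ≠ 1 := by rintro rfl; simp at hlt
        have hc0 : 0 < c := Nat.pos_of_ne_zero (by rintro rfl; simp at hlt)
        have h1 := hp _ (Nat.minFac_prime hc) ((Nat.minFac_dvd c).trans (Dvd.intro_left d rfl))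
        rw [mul_comm]
        exact Nat.mul_le_mul_left d (h1.trans (Nat.minFac_le hc0))
    _ ≤ #n.divisors * n := by
        rw [sum_const, smul_eq_mul]
        gcongr
        exact Nat.properDivisors_subset_divisors

theorem isSquare_of_odd_sigma {m : ℕ} (hm : Odd m) (h : Odd (sigma m)) : IsSquare m := by
  by_contra hsq
  have h0 : ∑ d ∈ m.divisors, (d : ZMod 2) = 0 := by
    refine sum_involution (fun d _ => m / d) ?_ ?_ ?_ ?_
    · intro d hd
      have hdm := Nat.dvd_of_mem_divisors hd
      rw [((ZMod.natCast_eq_one_iff_odd).2 (hm.of_dvd_nat hdm)),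
        ((ZMod.natCast_eq_one_iff_odd).2 (hm.of_dvd_nat (Nat.div_dvd_of_dvd hdm)))]
      decide
    · intro d hd _ he
      refine hsq ⟨d, ?_⟩
      have := Nat.div_mul_cancel (Nat.dvd_of_mem_divisors hd)
      rw [he] at this
      exact this.symm
    · intro d hd
      exact Nat.mem_divisors.2 ⟨Nat.div_dvd_of_dvd (Nat.dvd_of_mem_divisors hd),
        (Nat.mem_divisors.1 hd).2⟩
    · intro d hd
      exact Nat.div_div_self (Nat.dvd_of_mem_divisors hd) (Nat.mem_divisors.1 hd).2
  rw [← Nat.cast_sum, show ∑ d ∈ m.divisors, d = sigma m from rfl,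
    (ZMod.natCast_eq_one_iff_odd).2 h] at h0
  exact one_ne_zero h0

/-! ### The divisor bound -/

theorem add_one_le_mul_rpow {η : ℝ} (hη : 0 < η) {p : ℕ} (hp : 2 ≤ p) (k : ℕ) :
    (k + 1 : ℝ) ≤ max 1 (1 / (η * Real.log 2)) * ((p : ℝ) ^ k) ^ η := by
  set K := max 1 (1 / (η * Real.log 2))
  have hl : 0 < η * Real.log 2 := mul_pos hη (Real.log_pos one_lt_two)
  have hp' : (2 : ℝ) ≤ p := by exact_mod_cast hp
  have h1 : 1 + k * (η * Real.log 2) ≤ ((p : ℝ) ^ k) ^ η := by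
    calc 1 + k * (η * Real.log 2) ≤ Real.exp (k * (η * Real.log 2)) := by
          linarith [Real.add_one_le_exp (k * (η * Real.log 2))]
      _ = ((2 : ℝ) ^ k) ^ η := by
          rw [Real.rpow_def_of_pos (by positivity), Real.log_pow]
          ring_nf
      _ ≤ ((p : ℝ) ^ k) ^ η := by gcongr
  have hK1 : 1 ≤ K := le_max_left _ _
  have hK2 : 1 ≤ K * (η * Real.log 2) := by
    rw [← div_le_iff₀ hl]
    exact le_max_right _ _
  have hk : (0 : ℝ) ≤ k := k.cast_nonneg
  calc (k + 1 : ℝ) ≤ K * (1 + k * (η * Real.log 2)) := by nlinarith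
    _ ≤ K * ((p : ℝ) ^ k) ^ η := by gcongr

theorem add_one_le_rpow {η : ℝ} (hη : 0 < η) {p : ℕ} (hp : (2 : ℝ) ^ (1 / η) ≤ p) (k : ℕ) :
    (k + 1 : ℝ) ≤ ((p : ℝ) ^ k) ^ η := by
  calc (k + 1 : ℝ) ≤ 2 ^ k := by exact_mod_cast Nat.lt_two_pow_self
    _ = (((2 : ℝ) ^ (1 / η)) ^ k) ^ η := by
      rw [← Real.rpow_natCast, ← Real.rpow_natCast, ← Real.rpow_mul zero_le_two,
        ← Real.rpow_mul zero_le_two]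
      congr 1
      field_simp
    _ ≤ ((p : ℝ) ^ k) ^ η := by gcongr

theorem exists_card_divisors_le {η : ℝ} (hη : 0 < η) :
    ∃ C : ℝ, ∀ n : ℕ, n ≠ 0 → (#n.divisors : ℝ) ≤ C * (n : ℝ) ^ η := by
  set K := max 1 (1 / (η * Real.log 2))
  have hK1 : 1 ≤ K := le_max_left _ _
  set P := ⌈(2 : ℝ) ^ (1 / η)⌉₊
  refine ⟨K ^ P, fun n hn => ?_⟩
  have hfac : (n : ℝ) ^ η = ∏ p ∈ n.primeFactors, ((p : ℝ) ^ n.factorization p) ^ η := by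
    rw [Real.finsetProd_rpow _ _ (fun _ _ => by positivity)]
    congr 1
    exact_mod_cast (Nat.prod_factorization_pow_eq_self hn).symm
  have hprod : ∏ p ∈ n.primeFactors, (if p < P then K else 1) ≤ K ^ P := by
    rw [← prod_filter, prod_const]
    refine pow_le_pow_right₀ hK1 ?_
    calc #{p ∈ n.primeFactors | p < P} ≤ #(range P) :=
          card_le_card fun p hp => mem_range.2 (mem_filter.1 hp).2
      _ = P := card_range P
  calc (#n.divisors : ℝ) = ∏ p ∈ n.primeFactors, ((n.factorization p : ℝ) + 1) := by
        rw [Nat.card_divisors hn]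
        push_cast
        rfl
    _ ≤ ∏ p ∈ n.primeFactors,
          ((if p < P then K else 1) * ((p : ℝ) ^ n.factorization p) ^ η) := by
        refine prod_le_prod (fun _ _ => by positivity) fun p hp => ?_
        split_ifs with h
        · exact add_one_le_mul_rpow hη (Nat.prime_of_mem_primeFactors hp).two_le _
        · rw [one_mul]
          exact add_one_le_rpow hη (Nat.ceil_le.1 (not_lt.1 h)) _
    _ ≤ K ^ P * (n : ℝ) ^ η := by
        rw [prod_mul_distrib, ← hfac]
        gcongr

/-! ### Counting cofactors of a fixed unitary divisor -/

theorem card_le_of_dvd_sub {A : Finset ℕ} {q : ℕ} (hq : 0 < q) {X : ℝ}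
    (hdvd : ∀ x ∈ A, ∀ y ∈ A, x ≤ y → q ∣ y - x)
    (hX : ∀ x ∈ A, ∀ y ∈ A, (y : ℝ) - x ≤ X) (hX0 : 0 ≤ X) : (#A : ℝ) ≤ 1 + X / q := by
  rcases A.eq_empty_or_nonempty with rfl | hA
  · simp only [card_empty, Nat.cast_zero]
    positivity
  have hmin := A.min'_mem hA
  have hmin_le : ∀ x ∈ A, A.min' hA ≤ x := fun x hx => A.min'_le x hx
  have hcard : #A ≤ #(range (⌊X / q⌋₊ + 1)) := by
    refine card_le_card_of_injOn (fun x => (x - A.min' hA) / q) ?_ ?_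
    · intro x hx
      rw [mem_coe, mem_range, Nat.lt_succ_iff]
      refine Nat.le_floor ?_
      refine Nat.cast_div_le.trans ?_
      gcongr
      rw [Nat.cast_sub (hmin_le x hx)]
      exact hX _ hmin _ hx
    · intro x hx y hy hxy
      have h1 := Nat.div_mul_cancel (hdvd _ hmin x hx (hmin_le x hx))
      have h2 := Nat.div_mul_cancel (hdvd _ hmin y hy (hmin_le y hy))
      have h3 := hmin_le x hx
      have h4 := hmin_le y hy
      simp only at hxy
      rw [hxy] at h1
      lia
  rw [card_range] at hcard
  calc (#A : ℝ) ≤ (⌊X / q⌋₊ : ℝ) + 1 := by exact_mod_cast hcard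
    _ ≤ 1 + X / q := by
      rw [add_comm]
      gcongr
      exact Nat.floor_le (by positivity)

/-- The reciprocal of `a / gcd a (sigma a)`, restricted to those `a` for which
`sigma a * y = a * x + n` can be solvable. -/
noncomputable def gcdWeight (n a : ℕ) : ℝ :=
  if a.gcd (sigma a) ∣ n then (a.gcd (sigma a) : ℝ) / a else 0

theorem gcdWeight_nonneg (n a : ℕ) : 0 ≤ gcdWeight n a := by
  unfold gcdWeight
  split_ifs <;> positivity

theorem gcd_sigma_dvd {a e n : ℕ} (h : sigma a * sigma e = a * e + n) :
    a.gcd (sigma a) ∣ n := by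
  have h1 : a.gcd (sigma a) ∣ a * e + n := h ▸ (Nat.gcd_dvd_right a _).mul_right _
  exact (Nat.dvd_add_right ((Nat.gcd_dvd_left a _).mul_right e)).1 h1

theorem sigma_div_gcd_dvd_sub {a x y n : ℕ} (ha : 0 < a)
    (hx : sigma a * sigma x = a * x + n) (hy : sigma a * sigma y = a * y + n) :
    sigma a / a.gcd (sigma a) ∣ y - x := by
  have hg : 0 < a.gcd (sigma a) := Nat.gcd_pos_of_pos_left _ ha
  have h1 : sigma a ∣ a * (y - x) :=
    ⟨sigma y - sigma x, by rw [Nat.mul_sub, Nat.mul_sub, hx, hy]; lia⟩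
  have h2 : sigma a / a.gcd (sigma a) ∣ a / a.gcd (sigma a) * (y - x) := by
    refine Nat.dvd_of_mul_dvd_mul_left hg ?_
    rwa [← mul_assoc, Nat.mul_div_cancel' (Nat.gcd_dvd_right _ _),
      Nat.mul_div_cancel' (Nat.gcd_dvd_left _ _)]
  exact (Nat.coprime_div_gcd_div_gcd hg).symm.dvd_of_dvd_mul_left h2

theorem card_cofactors_le {A : Finset ℕ} {a n : ℕ} (ha : 0 < a) {X : ℝ}
    (hA : ∀ e ∈ A, sigma a * sigma e = a * e + n)
    (hX : ∀ x ∈ A, ∀ y ∈ A, (y : ℝ) - x ≤ X) (hX0 : 0 ≤ X) :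
    (#A : ℝ) ≤ 1 + X * gcdWeight n a := by
  rcases A.eq_empty_or_nonempty with rfl | ⟨e, he⟩
  · have := gcdWeight_nonneg n a
    simp only [card_empty, Nat.cast_zero]
    positivity
  have hg : 0 < a.gcd (sigma a) := Nat.gcd_pos_of_pos_left _ ha
  have hσ : 0 < sigma a := ha.trans_le (self_le_sigma a)
  have hq : 0 < sigma a / a.gcd (sigma a) :=
    Nat.div_pos (Nat.le_of_dvd hσ (Nat.gcd_dvd_right _ _)) hg
  refine (card_le_of_dvd_sub hq
    (fun x hx y hy _ => sigma_div_gcd_dvd_sub ha (hA x hx) (hA y hy)) hX hX0).trans ?_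
  rw [gcdWeight, if_pos (gcd_sigma_dvd (hA e he)),
    Nat.cast_div (Nat.gcd_dvd_right _ _) (by positivity), div_eq_mul_inv, inv_div]
  gcongr
  exact self_le_sigma a

theorem sum_dvd_div_le (M g : ℕ) (hg : 0 < g) :
    ∑ a ∈ Icc 1 M, (if g ∣ a then (g : ℝ) / a else 0) ≤ 1 + Real.log M := by
  have hinj : Function.Injective (g * ·) := mul_right_injective₀ hg.ne'
  calc ∑ a ∈ Icc 1 M, (if g ∣ a then (g : ℝ) / a else 0)
      = ∑ a ∈ Icc 1 M with g ∣ a, (g : ℝ) / a := (sum_filter _ _).symm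
    _ ≤ ∑ a ∈ (Icc 1 M).image (g * ·), (g : ℝ) / a := by
        refine sum_le_sum_of_subset_of_nonneg ?_ fun _ _ _ => by positivity
        intro a ha
        obtain ⟨ha, b, rfl⟩ := mem_filter.1 ha
        rw [mem_Icc] at ha
        have hb : 0 < b := Nat.pos_of_mul_pos_left ha.1
        exact mem_image_of_mem _ (mem_Icc.2 ⟨hb, (Nat.le_mul_of_pos_left b hg).trans ha.2⟩)
    _ = ∑ b ∈ Icc 1 M, ((b : ℝ))⁻¹ := by
        rw [sum_image hinj.injOn]
        refine sum_congr rfl fun b hb => ?_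
        have : (g : ℝ) ≠ 0 := by positivity
        push_cast
        rw [div_mul_eq_div_div, div_self this, one_div]
    _ ≤ 1 + Real.log M := by
        simpa [harmonic_eq_sum_Icc] using harmonic_le_one_add_log M

theorem sum_gcdWeight_le {n : ℕ} (hn : 0 < n) (M : ℕ) :
    ∑ a ∈ Icc 1 M, gcdWeight n a ≤ #n.divisors * (1 + Real.log M) := by
  calc ∑ a ∈ Icc 1 M, gcdWeight n a
      ≤ ∑ a ∈ Icc 1 M, ∑ g ∈ n.divisors, (if g ∣ a then (g : ℝ) / a else 0) := by
        refine sum_le_sum fun a _ => ?_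
        have hnn : ∀ g ∈ n.divisors, (0 : ℝ) ≤ if g ∣ a then (g : ℝ) / a else 0 := by
          intro g _
          split_ifs <;> positivity
        unfold gcdWeight
        split_ifs with h
        · simpa [Nat.gcd_dvd_left] using
            single_le_sum hnn (Nat.mem_divisors.2 ⟨h, hn.ne'⟩)
        · exact sum_nonneg hnn
    _ = ∑ g ∈ n.divisors, ∑ a ∈ Icc 1 M, (if g ∣ a then (g : ℝ) / a else 0) := sum_comm
    _ ≤ ∑ _g ∈ n.divisors, (1 + Real.log M) :=
        sum_le_sum fun g hg => sum_dvd_div_le M g (Nat.pos_of_mem_divisors hg)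
    _ = #n.divisors * (1 + Real.log M) := by rw [sum_const, nsmul_eq_mul]

/-! ### Splitting an integer at a threshold -/

theorem exists_split_aux (N : ℕ) : ∀ e d : ℕ, 0 < e → d.Coprime e → d ≤ N → N < d * e →
    (2 ∣ d ∨ d = 1 ∧ 2 ∣ e) →
    ∃ c p k f : ℕ, p.Prime ∧ 0 < k ∧ d * e = c * p ^ k * f ∧ c.Coprime p ∧
      (c * p ^ k).Coprime f ∧ (∀ q, q.Prime → q ∣ f → p ≤ q) ∧ c ≤ N ∧ N < c * p ^ k ∧
      (2 ∣ c ∨ c = 1 ∧ p = 2) := by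
  intro e
  induction e using Nat.strong_induction_on with
  | _ e ih =>
    intro d he hde hdN hN h2
    have he1 : e ≠ 1 := by rintro rfl; lia
    have hp := Nat.minFac_prime he1
    set p := e.minFac with hpdef
    obtain ⟨k, f, hpf, hef⟩ := Nat.exists_eq_pow_mul_and_not_dvd he.ne' p hp.ne_one
    have hk : k ≠ 0 := by
      rintro rfl
      rw [pow_zero, one_mul] at hef
      exact hpf (hef ▸ Nat.minFac_dvd e)
    have hdp : d.Coprime p := hde.coprime_dvd_right (Nat.minFac_dvd e)
    have hdf : d.Coprime f := hde.coprime_dvd_right (hef ▸ Nat.dvd_mul_left f _)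
    have hcop : (d * p ^ k).Coprime f :=
      hdf.mul_left (((Nat.Prime.coprime_iff_not_dvd hp).2 hpf).pow_left k)
    have hf : 0 < f := Nat.pos_of_ne_zero (by rintro rfl; simp at hpf)
    have hp2 : d = 1 ∧ 2 ∣ e → p = 2 := fun h => (Nat.minFac_eq_two_iff e).2 h.2
    have hprod : d * e = d * p ^ k * f := by rw [mul_assoc, ← hef]
    by_cases hlt : N < d * p ^ k
    · exact ⟨d, p, k, f, hp, Nat.pos_of_ne_zero hk, hprod, hdp, hcop,
        fun q hq hqf => Nat.minFac_le_of_dvd hq.two_le (hef ▸ hqf.mul_left _), hdN, hlt,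
        h2.imp_right fun h => ⟨h.1, hp2 h⟩⟩
    · have hfe : f < e := by
        rw [hef]
        exact lt_mul_of_one_lt_left hf (Nat.one_lt_pow hk hp.one_lt)
      have h2' : 2 ∣ d * p ^ k := by
        rcases h2 with h | h
        · exact h.mul_right _
        · rw [hp2 h]
          exact (dvd_pow_self 2 hk).mul_left _
      rw [hprod] at hN ⊢
      exact ih f hfe (d * p ^ k) hf hcop (not_lt.1 hlt) hN (Or.inl h2')

/-- An even `m > N` factors as `c * p ^ k * f`, where the primes dividing `c` are smaller than `p`
and those dividing `f` are larger, with `c ≤ N < c * p ^ k`. -/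
theorem exists_split {N m : ℕ} (hN : 0 < N) (hm : Even m) (hNm : N < m) :
    ∃ c p k f : ℕ, p.Prime ∧ 0 < k ∧ m = c * p ^ k * f ∧ c.Coprime p ∧
      (c * p ^ k).Coprime f ∧ (∀ q, q.Prime → q ∣ f → p ≤ q) ∧ c ≤ N ∧ N < c * p ^ k ∧
      (2 ∣ c ∨ c = 1 ∧ p = 2) := by
  simpa using exists_split_aux N m 1 (by lia) (Nat.coprime_one_left m) hN (by lia)
    (Or.inr ⟨rfl, hm.two_dvd⟩)

/-! ### Even preimages -/

theorem le_two_mul_of_even {m n : ℕ} (hm : Even m) (hm0 : 0 < m) (h : sigma m = m + n) :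
    m ≤ 2 * n := by
  obtain ⟨r, rfl⟩ := hm
  have := add_le_sigma_of_mem_properDivisors (n := r + r) (d := r)
    (Nat.mem_properDivisors.2 ⟨⟨2, by ring⟩, by lia⟩)
  lia

/-- The `e` for which `a * e ≤ 2 * n` is an `s`-preimage of `n`, assuming `a` is a unitary
divisor. -/
def cofactors (n a : ℕ) : Finset ℕ :=
  {e ∈ Icc 1 (2 * n) | a * e ≤ 2 * n ∧ sigma a * sigma e = a * e + n}

theorem mem_cofactors {n a e : ℕ} (ha : 0 < a) (he : 0 < e) (h : a * e ≤ 2 * n)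
    (hs : sigma a * sigma e = a * e + n) : e ∈ cofactors n a :=
  mem_filter.2 ⟨mem_Icc.2 ⟨he, (Nat.le_mul_of_pos_left e ha).trans h⟩, h, hs⟩

theorem card_cofactors_le_of_lt {n N a : ℕ} (hnN : n < N ^ 2) (ha : N < a) :
    (#(cofactors n a) : ℝ) ≤ 1 + 2 * N * gcdWeight n a := by
  have ha0 : 0 < a := by lia
  refine card_cofactors_le ha0 (fun e he => (mem_filter.1 he).2.2) ?_ (by positivity)
  intro x _ y hy
  have h1 := (mem_filter.1 hy).2.1
  have h2 : y ≤ 2 * N := by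
    by_contra! h
    nlinarith
  have h3 : (y : ℝ) ≤ 2 * N := by exact_mod_cast h2
  linarith [(x.cast_nonneg : (0 : ℝ) ≤ x)]

/-- The `e ∈ cofactors n d` for which `sigma e / e - 1 ≤ L * d / N`. -/
noncomputable def roughCofactors (n d N : ℕ) (L : ℝ) : Finset ℕ :=
  {e ∈ cofactors n d | (N : ℝ) * (sigma e - e) ≤ L * e * d}

theorem two_mul_sigma_ge {d : ℕ} (hd : 2 ∣ d) (hd0 : 0 < d) : d ≤ 2 * (sigma d - d) := by
  obtain ⟨r, rfl⟩ := hd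
  have := add_le_sigma_of_mem_properDivisors (n := 2 * r) (d := r)
    (Nat.mem_properDivisors.2 ⟨⟨2, by ring⟩, by lia⟩)
  lia

theorem card_roughCofactors_le {n N d : ℕ} {L : ℝ} (hnN : n < N ^ 2) (hd : 2 ∣ d) (hd0 : 0 < d)
    (hL : sigma d ≤ L * d) :
    (#(roughCofactors n d N L) : ℝ) ≤ 1 + 4 * L ^ 2 * N * gcdWeight n d := by
  have hN : 0 < N := Nat.pos_of_ne_zero (by rintro rfl; simp at hnN)
  have hd' : (0 : ℝ) < d := by exact_mod_cast hd0
  have hdσ : (d : ℝ) ≤ sigma d := by exact_mod_cast self_le_sigma d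
  have hL1 : 1 ≤ L := le_of_mul_le_mul_right (by linarith) hd'
  refine card_cofactors_le hd0 (fun e he => (mem_filter.1 (mem_filter.1 he).1).2.2) ?_
    (by positivity)
  intro x hx y hy
  obtain ⟨hx, hxL⟩ := mem_filter.1 hx
  obtain ⟨-, hxn, hxσ⟩ := mem_filter.1 hx
  obtain ⟨-, -, hyσ⟩ := mem_filter.1 (mem_filter.1 hy).1
  have hxn' : (d : ℝ) * x ≤ 2 * n := by exact_mod_cast hxn
  have hxσ' : (sigma d : ℝ) * sigma x = d * x + n := by exact_mod_cast hxσ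
  have hyσ' : (sigma d : ℝ) * sigma y = d * y + n := by exact_mod_cast hyσ
  have hy1 : (y : ℝ) ≤ sigma y := by exact_mod_cast self_le_sigma y
  have hhalf : (d : ℝ) ≤ 2 * (sigma d - d) := by
    have := two_mul_sigma_ge hd hd0
    rw [← Nat.cast_sub (self_le_sigma d)]
    exact_mod_cast this
  have hN' : (0 : ℝ) < N := by exact_mod_cast hN
  have hnN' : (n : ℝ) ≤ N ^ 2 := by exact_mod_cast hnN.le
  rcases le_total (y : ℝ) x with hyx | hxy
  · have : 0 ≤ 4 * L ^ 2 * N := by positivity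
    linarith
  have h1 : (sigma d - d : ℝ) * (y - x) ≤ sigma d * (sigma x - x) := by
    have := mul_le_mul_of_nonneg_left hy1 (by linarith : (0 : ℝ) ≤ sigma d)
    nlinarith
  have h2 : (N : ℝ) * (sigma d * (sigma x - x)) ≤ 2 * L ^ 2 * n * d := by
    calc (N : ℝ) * (sigma d * (sigma x - x)) = sigma d * (N * (sigma x - x)) := by ring
      _ ≤ sigma d * (L * x * d) := by gcongr
      _ ≤ (L * d) * (L * x * d) := by gcongr
      _ = L ^ 2 * d * (d * x) := by ring
      _ ≤ L ^ 2 * d * (2 * n) := by gcongr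
      _ = _ := by ring
  have h3 : (d : ℝ) * N * (y - x) ≤ d * N * (4 * L ^ 2 * N) := by
    calc (d : ℝ) * N * (y - x) ≤ 2 * (sigma d - d) * N * (y - x) := by
          have : 0 ≤ (y : ℝ) - x := by linarith
          gcongr
      _ = 2 * (N * ((sigma d - d) * (y - x))) := by ring
      _ ≤ 2 * (N * (sigma d * (sigma x - x))) := by gcongr
      _ ≤ 2 * (2 * L ^ 2 * n * d) := by gcongr
      _ ≤ 2 * (2 * L ^ 2 * N ^ 2 * d) := by gcongr
      _ = _ := by ring
  exact le_of_mul_le_mul_left h3 (by positivity)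

/-- The integers `d * p ^ k` with `d * p ≤ N` and `k < K`. -/
def powerLifts (N K : ℕ) : Finset ℕ :=
  (((Icc 1 N).sigma fun u => u.divisorsAntidiagonal) ×ˢ range K).image
    fun x => x.1.2.1 * x.1.2.2 ^ x.2

theorem mul_pow_mem_powerLifts {N K d p k : ℕ} (hdp : 0 < d * p) (h : d * p ≤ N) (hk : k < K) :
    d * p ^ k ∈ powerLifts N K :=
  mem_image.2 ⟨(⟨d * p, (d, p)⟩, k), by simp [hk, h]; lia, rfl⟩

theorem card_powerLifts_le (N K : ℕ) {L : ℝ} (hL : ∀ u ∈ Icc 1 N, (#u.divisors : ℝ) ≤ L) :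
    (#(powerLifts N K) : ℝ) ≤ N * L * K := by
  calc (#(powerLifts N K) : ℝ)
      ≤ #(((Icc 1 N).sigma fun u => u.divisorsAntidiagonal) ×ˢ range K) := by
        exact_mod_cast card_image_le
    _ = (∑ u ∈ Icc 1 N, (#u.divisors : ℝ)) * K := by
        rw [card_product, card_sigma, card_range]
        push_cast
        congr 1
        refine sum_congr rfl fun u _ => ?_
        rw [← Nat.map_div_right_divisors, card_map]
    _ ≤ (∑ _u ∈ Icc 1 N, L) * K := by
        gcongr with u hu
        exact hL u hu
    _ = N * L * K := by simp

/-- The even `s`-preimages of `n`; see `le_two_mul_of_even` for the range. -/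
def evenPreimages (n : ℕ) : Finset ℕ :=
  {m ∈ Icc 1 (2 * n) | Even m ∧ sigma m = m + n}

theorem evenPreimages_subset {n N : ℕ} {L : ℝ} (hN2 : 2 ≤ N)
    (hL : ∀ u ∈ Icc 1 (2 * n), (#u.divisors : ℝ) ≤ L) :
    evenPreimages n ⊆ Icc 1 N ∪
      (({a ∈ Icc 1 (2 * n) | N < a} ∩ powerLifts N ⌊L⌋₊).biUnion
        fun a => (cofactors n a).image (a * ·)) ∪
      ({d ∈ Icc 1 (2 * n) | d ≤ N ∧ 2 ∣ d}.biUnion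
        fun d => (roughCofactors n d N L).image (d * ·)) := by
  intro m hm
  obtain ⟨hm, heven, hσ⟩ := mem_filter.1 hm
  obtain ⟨hm1, hm2⟩ := mem_Icc.1 hm
  rw [mem_union, mem_union]
  rcases le_or_gt m N with hmN | hmN
  · exact Or.inl (Or.inl (mem_Icc.2 ⟨hm1, hmN⟩))
  obtain ⟨d, p, k, f, hp, hk, rfl, hdp, hcop, hrough, hdN, hN, hd2⟩ :=
    exists_split (by lia) heven hmN
  have hd0 : 0 < d := Nat.pos_of_ne_zero (by rintro rfl; simp at hN)
  have hf0 : 0 < f := Nat.pos_of_ne_zero (by rintro rfl; simp at hm1)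
  have hpk0 : 0 < p ^ k := pow_pos hp.pos k
  have hlt : ∀ x, x ∣ d * p ^ k * f → x ∈ Icc 1 (2 * n) := fun x hx =>
    mem_Icc.2 ⟨Nat.pos_of_dvd_of_pos hx hm1, (Nat.le_of_dvd hm1 hx).trans hm2⟩
  rcases le_or_gt (d * p) N with hsmall | hlarge
  · refine Or.inl (Or.inr (mem_biUnion.2 ⟨d * p ^ k, mem_inter.2 ⟨mem_filter.2 ⟨hlt _ ⟨f, rfl⟩, hN⟩,
      mul_pow_mem_powerLifts (Nat.mul_pos hd0 hp.pos) hsmall ?_⟩, mem_image.2 ⟨f, ?_, rfl⟩⟩))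
    · have h1 := hL (p ^ k) (hlt _ ⟨d * f, by ring⟩)
      rw [Nat.divisors_prime_pow hp, card_map, card_range] at h1
      exact Nat.le_floor h1
    · refine mem_cofactors (Nat.mul_pos hd0 hpk0) hf0 hm2 ?_
      rw [← sigma_mul_of_coprime_s8 hcop, hσ]
  · refine Or.inr (mem_biUnion.2 ⟨d, mem_filter.2 ⟨hlt _ ⟨p ^ k * f, by ring⟩, hdN, ?_⟩,
      mem_image.2 ⟨p ^ k * f, mem_filter.2 ⟨?_, ?_⟩, (mul_assoc _ _ _).symm⟩⟩)
    · rcases hd2 with h | ⟨rfl, rfl⟩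
      · exact h
      · lia
    · refine mem_cofactors hd0 (Nat.mul_pos hpk0 hf0) (by rwa [← mul_assoc]) ?_
      rw [← sigma_mul_of_coprime_s8, ← mul_assoc, hσ]
      exact (hdp.pow_right k).mul_right (hcop.coprime_dvd_left (Nat.dvd_mul_right _ _))
    · set e := p ^ k * f with he
      have h1 : p * sigma e ≤ p * e + #e.divisors * e := by
        refine mul_sigma_le fun q hq hqe => ?_
        rcases (Nat.Prime.dvd_mul hq).1 hqe with h | h
        · exact ((Nat.prime_dvd_prime_iff_eq hq hp).1 (hq.dvd_of_dvd_pow h)).ge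
        · exact hrough q hq h
      have h1' : (p : ℝ) * (sigma e - e) ≤ #e.divisors * e := by
        have : (p : ℝ) * sigma e ≤ p * e + #e.divisors * e := by exact_mod_cast h1
        linarith
      have h2 := hL e (hlt e ⟨d, by rw [he]; ring⟩)
      have h3 : (N : ℝ) ≤ d * p := by exact_mod_cast hlarge.le
      have h4 : (0 : ℝ) ≤ sigma e - e := by
        rw [sub_nonneg]
        exact_mod_cast self_le_sigma e
      calc (N : ℝ) * (sigma e - e) ≤ d * p * (sigma e - e) := by gcongr
        _ = d * (p * (sigma e - e)) := by ring
        _ ≤ d * (#e.divisors * e) := by gcongr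
        _ ≤ d * (L * e) := by gcongr
        _ = L * e * d := by ring

theorem card_evenPreimages_le {n N : ℕ} {L : ℝ} (hn : 0 < n) (hN2 : 2 ≤ N) (hNn : N ≤ 2 * n)
    (hnN : n < N ^ 2) (hL : ∀ u ∈ Icc 1 (2 * n), (#u.divisors : ℝ) ≤ L)
    (hlog : 1 + Real.log (2 * n : ℕ) ≤ L) :
    (#(evenPreimages n) : ℝ) ≤ 9 * N * L ^ 4 := by
  have hL1 : 1 ≤ L := by simpa using hL 1 (mem_Icc.2 ⟨le_rfl, by lia⟩)
  have hweight : ∑ a ∈ Icc 1 (2 * n), gcdWeight n a ≤ L * L := by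
    refine (sum_gcdWeight_le hn _).trans ?_
    have := hL n (mem_Icc.2 ⟨hn, by lia⟩)
    gcongr
  have hweight' : ∀ S ⊆ Icc 1 (2 * n), ∑ a ∈ S, gcdWeight n a ≤ L * L := fun S hS =>
    (sum_le_sum_of_subset_of_nonneg hS fun a _ _ => gcdWeight_nonneg n a).trans hweight
  set A := {a ∈ Icc 1 (2 * n) | N < a} ∩ powerLifts N ⌊L⌋₊ with hA
  set D := {d ∈ Icc 1 (2 * n) | d ≤ N ∧ 2 ∣ d} with hD
  have hAcard : (#A : ℝ) ≤ N * L * L := by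
    calc (#A : ℝ) ≤ #(powerLifts N ⌊L⌋₊) := by exact_mod_cast card_le_card inter_subset_right
      _ ≤ N * L * ⌊L⌋₊ :=
        card_powerLifts_le _ _ fun u hu => hL u (Icc_subset_Icc_right hNn hu)
      _ ≤ N * L * L := by
        gcongr
        exact Nat.floor_le (by linarith)
  have hDcard : (#D : ℝ) ≤ N := by
    have : #D ≤ #(Icc 1 N) := card_le_card fun d hd =>
      mem_Icc.2 ⟨(mem_Icc.1 (mem_filter.1 hd).1).1, (mem_filter.1 hd).2.1⟩
    rw [Nat.card_Icc, Nat.add_sub_cancel] at this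
    exact_mod_cast this
  have hsumA : ((∑ a ∈ A, #((cofactors n a).image (a * ·)) : ℕ) : ℝ)
      ≤ N * L * L + 2 * N * (L * L) := by
    push_cast
    calc ∑ a ∈ A, (#((cofactors n a).image (a * ·)) : ℝ)
        ≤ ∑ a ∈ A, (1 + 2 * N * gcdWeight n a) := by
          refine sum_le_sum fun a ha => ?_
          refine le_trans (by exact_mod_cast card_image_le)
            (card_cofactors_le_of_lt hnN (mem_filter.1 (mem_inter.1 ha).1).2)
      _ = #A + 2 * N * ∑ a ∈ A, gcdWeight n a := by
          rw [sum_add_distrib, mul_sum]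
          simp
      _ ≤ _ := by
          gcongr
          exact hweight' A (inter_subset_left.trans (filter_subset _ _))
  have hsumD : ((∑ d ∈ D, #((roughCofactors n d N L).image (d * ·)) : ℕ) : ℝ)
      ≤ N + 4 * L ^ 2 * N * (L * L) := by
    push_cast
    calc ∑ d ∈ D, (#((roughCofactors n d N L).image (d * ·)) : ℝ)
        ≤ ∑ d ∈ D, (1 + 4 * L ^ 2 * N * gcdWeight n d) := by
          refine sum_le_sum fun d hd => ?_
          obtain ⟨hd1, -, hd2⟩ := mem_filter.1 hd
          refine le_trans (by exact_mod_cast card_image_le)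
            (card_roughCofactors_le hnN hd2 (mem_Icc.1 hd1).1 ?_)
          calc (sigma d : ℝ) ≤ #d.divisors * d := by exact_mod_cast sigma_le_card_divisors_mul d
            _ ≤ L * d := by
              gcongr
              exact hL d hd1
      _ = #D + 4 * L ^ 2 * N * ∑ d ∈ D, gcdWeight n d := by
          rw [sum_add_distrib, mul_sum]
          simp
      _ ≤ _ := by
          gcongr
          exact hweight' D (filter_subset _ _)
  have hmain : #(evenPreimages n) ≤ N + (∑ a ∈ A, #((cofactors n a).image (a * ·))) +
      ∑ d ∈ D, #((roughCofactors n d N L).image (d * ·)) := by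
    refine (card_le_card (evenPreimages_subset hN2 hL)).trans ?_
    refine (card_union_le _ _).trans (add_le_add ((card_union_le _ _).trans
      (add_le_add ?_ card_biUnion_le)) card_biUnion_le)
    simp
  have hmain' : (#(evenPreimages n) : ℝ) ≤
      N + (N * L * L + 2 * N * (L * L)) + (N + 4 * L ^ 2 * N * (L * L)) := by
    refine (Nat.cast_le.2 hmain).trans ?_
    push_cast at hsumA hsumD ⊢
    gcongr
  have hLsq : 1 ≤ L ^ 2 := one_le_pow₀ hL1
  have hNL : (N : ℝ) ≤ N * L ^ 2 := le_mul_of_one_le_right (by positivity) hLsq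
  have hNL' : (N : ℝ) * L ^ 2 ≤ N * L ^ 4 := by
    gcongr ?_ * ?_
    exact pow_le_pow_right₀ hL1 (by norm_num)
  nlinarith

/-! ### Odd preimages -/

theorem sigma_prime_pow_succ {p : ℕ} (hp : p.Prime) (i : ℕ) :
    sigma (p ^ (i + 1)) = sigma (p ^ i) + p ^ (i + 1) := by
  simp only [sigma, Nat.sum_divisors_prime_pow hp]
  exact sum_range_succ _ _

theorem sigma_prime_pow_lt {p q i : ℕ} (hp : p.Prime) (hq : q.Prime) (hpq : p < q) (hi : 0 < i) :
    sigma (p ^ i) < sigma (q ^ i) := by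
  simp only [sigma, Nat.sum_divisors_prime_pow hp, Nat.sum_divisors_prime_pow hq]
  exact sum_lt_sum (fun k _ => Nat.pow_le_pow_left hpq.le k)
    ⟨i, mem_range.2 (Nat.lt_succ_self i), Nat.pow_lt_pow_left hpq hi.ne'⟩

/-- For given `a` and `j`, at most one prime `p` satisfies
`sigma a * sigma (p ^ j) = a * p ^ j + n`. -/
theorem prime_le_of_sigma_mul_sigma_eq {a n j p q : ℕ} (ha : 0 < a) (hj : 1 < j) (hp : p.Prime)
    (hq : q.Prime) (hσp : sigma a * sigma (p ^ j) = a * p ^ j + n)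
    (hσq : sigma a * sigma (q ^ j) = a * q ^ j + n) : q ≤ p := by
  by_contra! hpq
  obtain ⟨i, rfl⟩ : ∃ i, j = i + 1 := ⟨j - 1, by lia⟩
  rw [sigma_prime_pow_succ hp] at hσp
  rw [sigma_prime_pow_succ hq] at hσq
  obtain ⟨t, ht⟩ := Nat.exists_eq_add_of_le (self_le_sigma a)
  rw [ht] at hσp hσq
  have h1 := Nat.mul_lt_mul_of_pos_left (sigma_prime_pow_lt hp hq hpq (i := i) (by lia))
    (by lia : 0 < a + t)
  have h2 := Nat.mul_le_mul_left t (Nat.pow_le_pow_left hpq.le (i + 1))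
  nlinarith

/-- The odd `s`-preimages of an even `n` are squares `(u * p ^ j) ^ 2` with `u ^ 2 ≤ n` and
`p ^ j ≤ n`. -/
theorem exists_eq_sq_of_odd {m n : ℕ} (hn : 0 < n) (hn2 : Even n) (hm : Odd m)
    (h : sigma m = m + n) :
    ∃ u p j : ℕ, p.Prime ∧ 0 < u ∧ 0 < j ∧ m = u ^ 2 * p ^ (2 * j) ∧ u.Coprime p ∧
      u ^ 2 ≤ n ∧ p ^ j ≤ n := by
  obtain ⟨k, hk⟩ := isSquare_of_odd_sigma hm (h ▸ hm.add_even hn2)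
  have hk0 : k ≠ 0 := by
    rintro rfl
    subst hk
    simp at hm
  have hk1 : k ≠ 1 := by
    rintro rfl
    subst hk
    simp [sigma] at h
    lia
  have hp := Nat.minFac_prime hk1
  set p := k.minFac
  obtain ⟨c, hc⟩ : p ∣ k := Nat.minFac_dvd k
  have hkn : c * k ≤ n := by
    have h1 : c * k ∈ m.properDivisors := by
      refine Nat.mem_properDivisors.2 ⟨⟨p, by rw [hk]; nth_rewrite 2 [hc]; ring⟩, ?_⟩
      rw [hk]
      refine Nat.mul_lt_mul_of_pos_right ?_ (Nat.pos_of_ne_zero hk0)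
      rw [hc]
      exact lt_mul_of_one_lt_left (Nat.pos_of_ne_zero (by rintro rfl; simp [hk0] at hc)) hp.one_lt
    have := add_le_sigma_of_mem_properDivisors h1
    lia
  obtain ⟨j, u, hpu, hku⟩ := Nat.exists_eq_pow_mul_and_not_dvd hk0 p hp.ne_one
  have hu : 0 < u := Nat.pos_of_ne_zero (by rintro rfl; simp at hpu)
  obtain ⟨i, rfl⟩ : ∃ i, j = i + 1 := by
    refine ⟨j - 1, ?_⟩
    have : j ≠ 0 := by
      rintro rfl
      rw [pow_zero, one_mul] at hku
      exact hpu (hku ▸ Nat.minFac_dvd k)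
    lia
  have hc' : c = p ^ i * u := by
    refine Nat.eq_of_mul_eq_mul_left hp.pos ?_
    rw [← hc, hku]
    ring
  have hppos : ∀ t, 0 < p ^ t := fun t => pow_pos hp.pos t
  have hprod : u ^ 2 * p ^ i * p ^ (i + 1) ≤ n := by
    calc u ^ 2 * p ^ i * p ^ (i + 1) = c * k := by rw [hc', hku]; ring
      _ ≤ n := hkn
  refine ⟨u, p, i + 1, hp, hu, Nat.succ_pos i, by rw [hk, hku]; ring,
    ((Nat.Prime.coprime_iff_not_dvd hp).2 hpu).symm, ?_, ?_⟩
  · refine le_trans ?_ hprod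
    rw [mul_assoc]
    exact Nat.le_mul_of_pos_right _ (Nat.mul_pos (hppos _) (hppos _))
  · exact (Nat.le_mul_of_pos_left _ (Nat.mul_pos (pow_pos hu 2) (hppos _))).trans hprod

theorem card_odd_preimages_le {n N : ℕ} {L : ℝ} (hn : 0 < n) (hn2 : Even n) (hnN : n < N ^ 2)
    (hL : ∀ u ∈ Icc 1 (2 * n), (#u.divisors : ℝ) ≤ L) :
    {m : ℕ | Odd m ∧ sigma m = m + n}.Finite ∧
      ({m : ℕ | Odd m ∧ sigma m = m + n}.ncard : ℝ) ≤ N * L := by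
  have hL1 : 1 ≤ L := by simpa using hL 1 (mem_Icc.2 ⟨le_rfl, by lia⟩)
  choose! u p j hp hu hj hm hcop hun hpn using
    fun m (h : Odd m ∧ sigma m = m + n) => exists_eq_sq_of_odd hn hn2 h.1 h.2
  have hmaps : Set.MapsTo (fun m => (u m, j m)) {m : ℕ | Odd m ∧ sigma m = m + n}
      (Icc 1 N ×ˢ range ⌊L⌋₊ : Finset (ℕ × ℕ)) := by
    intro m h
    rw [mem_coe, mem_product, mem_Icc, mem_range]
    refine ⟨⟨hu m h, (Nat.pow_lt_pow_iff_left two_ne_zero).1 ((hun m h).trans_lt hnN) |>.le⟩,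
      Nat.le_floor ?_⟩
    have h1 := hL (p m ^ j m) (mem_Icc.2 ⟨pow_pos (hp m h).pos _, (hpn m h).trans (by lia)⟩)
    rwa [Nat.divisors_prime_pow (hp m h), card_map, card_range] at h1
  have heq : ∀ m, Odd m ∧ sigma m = m + n →
      sigma (u m ^ 2) * sigma (p m ^ (2 * j m)) = u m ^ 2 * p m ^ (2 * j m) + n := by
    intro m h
    rw [← sigma_mul_of_coprime_s8 ((hcop m h).pow _ _), ← hm m h, h.2]
  have hinj : Set.InjOn (fun m => (u m, j m)) {m : ℕ | Odd m ∧ sigma m = m + n} := by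
    intro m h m' h' hmm
    obtain ⟨hu', hj'⟩ := Prod.mk.inj hmm
    have h1 := heq m h
    have h2 := heq m' h'
    rw [← hu', ← hj'] at h2
    have hu2 : 0 < u m ^ 2 := pow_pos (hu m h) 2
    have hj2 : 1 < 2 * j m := by have := hj m h; lia
    have hpp : p m = p m' := le_antisymm
      (prime_le_of_sigma_mul_sigma_eq hu2 hj2 (hp m' h') (hp m h) h2 h1)
      (prime_le_of_sigma_mul_sigma_eq hu2 hj2 (hp m h) (hp m' h') h1 h2)
    rw [hm m h, hm m' h', hu', hj', hpp]
  refine ⟨Set.Finite.of_injOn hmaps hinj (finite_toSet _), ?_⟩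
  have hcard := Set.ncard_le_ncard_of_injOn _ hmaps hinj (finite_toSet _)
  rw [Set.ncard_coe_finset, card_product, Nat.card_Icc, Nat.add_sub_cancel, card_range] at hcard
  calc ({m : ℕ | Odd m ∧ sigma m = m + n}.ncard : ℝ) ≤ N * ⌊L⌋₊ := by exact_mod_cast hcard
    _ ≤ N * L := by
      gcongr
      exact Nat.floor_le (by linarith)

/-! ### The main theorem -/

theorem card_preimages_le {n N : ℕ} {L : ℝ} (hn : 0 < n) (hn2 : Even n) (hN2 : 2 ≤ N)
    (hNn : N ≤ 2 * n) (hnN : n < N ^ 2) (hL : ∀ u ∈ Icc 1 (2 * n), (#u.divisors : ℝ) ≤ L)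
    (hlog : 1 + Real.log (2 * n : ℕ) ≤ L) :
    {m : ℕ | 1 ≤ m ∧ s m = n}.Finite ∧
      ({m : ℕ | 1 ≤ m ∧ s m = n}.ncard : ℝ) ≤ 10 * N * L ^ 4 := by
  have hL1 : 1 ≤ L := by simpa using hL 1 (mem_Icc.2 ⟨le_rfl, by lia⟩)
  obtain ⟨hfin, hodd⟩ := card_odd_preimages_le hn hn2 hnN hL
  have heven := card_evenPreimages_le hn hN2 hNn hnN hL hlog
  have hsub : {m : ℕ | 1 ≤ m ∧ s m = n} ⊆
      {m : ℕ | Odd m ∧ sigma m = m + n} ∪ evenPreimages n := by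
    rintro m ⟨hm, hs⟩
    rw [s_eq_iff] at hs
    rcases Nat.even_or_odd m with h | h
    · exact Or.inr (mem_filter.2 ⟨mem_Icc.2 ⟨hm, le_two_mul_of_even h hm hs⟩, h, hs⟩)
    · exact Or.inl ⟨h, hs⟩
  have hfin' := hfin.union (finite_toSet (evenPreimages n))
  refine ⟨hfin'.subset hsub, ?_⟩
  have hcard := (Set.ncard_le_ncard hsub hfin').trans (Set.ncard_union_le _ _)
  rw [Set.ncard_coe_finset] at hcard
  have hLL : (N : ℝ) * L ≤ N * L ^ 4 := by
    gcongr ?_ * ?_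
    exact le_self_pow₀ hL1 (by norm_num)
  have hcard' : ({m : ℕ | 1 ≤ m ∧ s m = n}.ncard : ℝ) ≤
      {m : ℕ | Odd m ∧ sigma m = m + n}.ncard + #(evenPreimages n) := by exact_mod_cast hcard
  linarith

theorem card_s_inverse_le (ε : ℝ) (hε : 0 < ε) :
    ∃ C : ℝ, 0 < C ∧ ∀ n : ℕ, 0 < n → Even n →
      {m : ℕ | 1 ≤ m ∧ s m = n}.Finite ∧
      ({m : ℕ | 1 ≤ m ∧ s m = n}.ncard : ℝ) ≤ C * (n : ℝ) ^ ((1 : ℝ) / 2 + ε) := by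
  have hη : 0 < ε / 4 := by positivity
  obtain ⟨C₀, hC₀⟩ := exists_card_divisors_le hη
  set C₁ := max C₀ (1 + 1 / (ε / 4))
  have hC₁ : 0 < C₁ := lt_of_lt_of_le (by positivity) (le_max_right _ _)
  refine ⟨20 * C₁ ^ 4 * 2 ^ ε, by positivity, fun n hn hn2 => ?_⟩
  have hn1 : (1 : ℝ) ≤ n := by exact_mod_cast hn
  have hsqrt : 0 < n.sqrt := Nat.sqrt_pos.2 hn
  set X := (2 * n : ℕ) with hX
  have hX1 : (1 : ℝ) ≤ X := by exact_mod_cast (by lia : 1 ≤ X)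
  have hL : ∀ u ∈ Icc 1 X, (#u.divisors : ℝ) ≤ C₁ * (X : ℝ) ^ (ε / 4) := by
    intro u hu
    obtain ⟨hu1, hu2⟩ := mem_Icc.1 hu
    refine (hC₀ u (by lia)).trans ?_
    gcongr
    exact le_max_left _ _
  have hlog : 1 + Real.log X ≤ C₁ * (X : ℝ) ^ (ε / 4) := by
    have h1 := Real.log_le_rpow_div (by positivity : (0 : ℝ) ≤ X) hη
    have h2 := Real.one_le_rpow hX1 hη.le
    calc 1 + Real.log X ≤ (1 + 1 / (ε / 4)) * (X : ℝ) ^ (ε / 4) := by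
          rw [add_mul, one_mul, div_mul_eq_mul_div, one_mul]
          gcongr
      _ ≤ _ := by
          gcongr
          exact le_max_right _ _
  obtain ⟨hfin, hcard⟩ := card_preimages_le (N := n.sqrt + 1) hn hn2 (by lia)
    (by have := n.sqrt_le_self; lia) (Nat.lt_succ_sqrt' n) hL hlog
  refine ⟨hfin, hcard.trans ?_⟩
  have hN : ((n.sqrt + 1 : ℕ) : ℝ) ≤ 2 * (n : ℝ) ^ ((1 : ℝ) / 2) := by
    rw [← Real.sqrt_eq_rpow]
    have h1 : (n.sqrt : ℝ) ≤ √n := Real.nat_sqrt_le_real_sqrt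
    have h2 : (1 : ℝ) ≤ √n := Real.one_le_sqrt.2 hn1
    push_cast
    linarith
  have hpow : (C₁ * (X : ℝ) ^ (ε / 4)) ^ 4 = C₁ ^ 4 * (2 ^ ε * (n : ℝ) ^ ε) := by
    rw [mul_pow, ← Real.rpow_natCast ((X : ℝ) ^ (ε / 4)), ← Real.rpow_mul (by positivity), hX,
      Nat.cast_mul, Real.mul_rpow (by positivity) (by positivity)]
    norm_num
  rw [hpow, Real.rpow_add (by positivity)]
  calc 10 * ((n.sqrt + 1 : ℕ) : ℝ) * (C₁ ^ 4 * (2 ^ ε * (n : ℝ) ^ ε))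
      ≤ 10 * (2 * (n : ℝ) ^ ((1 : ℝ) / 2)) * (C₁ ^ 4 * (2 ^ ε * (n : ℝ) ^ ε)) := by gcongr
    _ = _ := by ring
end

section
/- Assume that every even integer at least 8 is the sum of two distinct primes. Then for every odd integer n ≥ 9 there exist distinct odd primes p and q such that n = s(pq) = p + q + 1; moreover pq > n and pq is odd. -/
theorem sigma_prime {p : ℕ} (hp : p.Prime) : sigma p = p + 1 := by
  rw [sigma, hp.sum_divisors, add_comm]

theorem s_mul_of_distinct_primes {p q : ℕ} (hp : p.Prime) (hq : q.Prime) (hpq : p ≠ q) :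
    s (p * q) = p + q + 1 := by
  have hmul : sigma (p * q) = sigma p * sigma q :=
    ((Nat.coprime_primes hp hq).2 hpq).sum_divisors_mul
  rw [s, hmul, sigma_prime hp, sigma_prime hq]
  refine Nat.sub_eq_of_eq_add ?_
  ring

theorem odd_of_prime_of_even_add {p q : ℕ} (hp : p.Prime) (hq : q.Prime) (hpq : p ≠ q)
    (h : Even (p + q)) : Odd p := by
  by_contra hodd
  have hp2 : Even p := Nat.not_odd_iff_even.1 hodd
  have hq2 : Even q := (Nat.even_add.1 h).1 hp2
  exact hpq ((hp.even_iff.1 hp2).trans (hq.even_iff.1 hq2).symm)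

theorem odd_eq_s_of_semiprime_of_goldbach
    (hG : ∀ N : ℕ, Even N → 8 ≤ N → ∃ p q : ℕ, p.Prime ∧ q.Prime ∧ p ≠ q ∧ N = p + q)
    (n : ℕ) (hn : Odd n) (hn9 : 9 ≤ n) :
    ∃ p q : ℕ, p.Prime ∧ q.Prime ∧ p ≠ q ∧ Odd p ∧ Odd q ∧
      n = s (p * q) ∧ n = p + q + 1 ∧ n < p * q ∧ Odd (p * q) := by
  have heven : Even (n - 1) := hn.tsub_odd odd_one
  obtain ⟨p, q, hp, hq, hpq, hsum⟩ := hG (n - 1) heven (by omega)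
  have hn_eq : n = p + q + 1 := by omega
  rw [hsum] at heven
  have hpo : Odd p := odd_of_prime_of_even_add hp hq hpq heven
  have hqo : Odd q := odd_of_prime_of_even_add hq hp hpq.symm (by rwa [add_comm])
  have hp3 : 3 ≤ p := hp.odd_iff.1 hpo
  have hq3 : 3 ≤ q := hq.odd_iff.1 hqo
  refine ⟨p, q, hp, hq, hpq, hpo, hqo, ?_, hn_eq, ?_, hpo.mul hqo⟩
  · rw [s_mul_of_distinct_primes hp hq hpq, hn_eq]
  · nlinarith
end

section
/- For every integer n ≥ 4, the number of even integers a with 2 ≤ a ≤ 2n such that f(a) ≤ √n is at most (1/2)·√n·log₂(2n), where f(a) = a/p^{k−1} with p the largest prime factor of a and p^k the exact power of p dividing a. -/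
/-- The largest prime factor of `a` (junk value `0` for `a ≤ 1`). -/
def maxPrimeFac (a : ℕ) : ℕ := a.primeFactors.sup id

/-- `f a = a / p ^ (k - 1)`, where `p` is the largest prime factor of `a`
and `p ^ k` is the exact power of `p` dividing `a`. -/
def f (a : ℕ) : ℕ := a / (maxPrimeFac a) ^ (a.factorization (maxPrimeFac a) - 1)

theorem maxPrimeFac_mem {a : ℕ} (ha : 2 ≤ a) : maxPrimeFac a ∈ a.primeFactors := by
  obtain ⟨p, hp, h⟩ := Finset.exists_mem_eq_sup a.primeFactors
    (Nat.nonempty_primeFactors.2 ha) id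
  rw [maxPrimeFac, h]
  exact hp

theorem pow_mul_f (a : ℕ) :
    maxPrimeFac a ^ (a.factorization (maxPrimeFac a) - 1) * f a = a :=
  Nat.mul_div_cancel' ((pow_dvd_pow _ (Nat.sub_le _ 1)).trans (Nat.ordProj_dvd a _))

theorem maxPrimeFac_dvd_f {a : ℕ} (ha : 2 ≤ a) : maxPrimeFac a ∣ f a := by
  have hmem := maxPrimeFac_mem ha
  have hp := Nat.prime_of_mem_primeFactors hmem
  have hk : 0 < a.factorization (maxPrimeFac a) :=
    hp.factorization_pos_of_dvd (by lia) (Nat.dvd_of_mem_primeFactors hmem)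
  refine Nat.dvd_of_mul_dvd_mul_left (pow_pos hp.pos (a.factorization (maxPrimeFac a) - 1)) ?_
  rw [pow_mul_f, ← pow_succ, Nat.sub_add_cancel hk]
  exact Nat.ordProj_dvd a _

theorem primeFactors_f {a : ℕ} (ha : 2 ≤ a) : (f a).primeFactors = a.primeFactors := by
  have hfa : f a ∣ a := Dvd.intro_left _ (pow_mul_f a)
  have hp := Nat.prime_of_mem_primeFactors (maxPrimeFac_mem ha)
  have hf0 : f a ≠ 0 := ne_zero_of_dvd_ne_zero (by lia) hfa
  refine (Nat.primeFactors_mono hfa (by lia)).antisymm fun q hq => ?_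
  have hqp := Nat.prime_of_mem_primeFactors hq
  have hqa := Nat.dvd_of_mem_primeFactors hq
  rw [← pow_mul_f a, hqp.dvd_mul] at hqa
  refine Nat.mem_primeFactors.2 ⟨hqp, ?_, hf0⟩
  rcases hqa with h | h
  · rw [(Nat.prime_dvd_prime_iff_eq hqp hp).1 (hqp.dvd_of_dvd_pow h)]
    exact maxPrimeFac_dvd_f ha
  · exact h

theorem maxPrimeFac_f {a : ℕ} (ha : 2 ≤ a) : maxPrimeFac (f a) = maxPrimeFac a := by
  rw [maxPrimeFac, primeFactors_f ha, maxPrimeFac]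

theorem even_f {a : ℕ} (ha : 2 ≤ a) (he : Even a) : Even (f a) := by
  have h : 2 ∈ a.primeFactors := Nat.mem_primeFactors.2 ⟨Nat.prime_two, he.two_dvd, by lia⟩
  rw [← primeFactors_f ha] at h
  exact even_iff_two_dvd.2 (Nat.dvd_of_mem_primeFactors h)

theorem f_pos {a : ℕ} (ha : 2 ≤ a) : 0 < f a :=
  Nat.pos_of_dvd_of_pos (Dvd.intro_left _ (pow_mul_f a)) (by lia)

theorem ncard_small_f_le_mul (n : ℕ) :
    {a : ℕ | 2 ≤ a ∧ a ≤ 2 * n ∧ Even a ∧ (f a : ℝ) ≤ Real.sqrt n}.ncard ≤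
      (Nat.sqrt n / 2) * (Nat.log 2 n + 1) := by
  have hcard : (Nat.sqrt n / 2) * (Nat.log 2 n + 1) =
      ((Finset.Icc 1 (Nat.sqrt n / 2) ×ˢ Finset.range (Nat.log 2 n + 1) :
        Finset (ℕ × ℕ)) : Set (ℕ × ℕ)).ncard := by
    rw [Set.ncard_coe_finset]
    simp
  rw [hcard]
  refine Set.ncard_le_ncard_of_injOn
    (fun a => (f a / 2, a.factorization (maxPrimeFac a) - 1)) ?_ ?_ (Finset.finite_toSet _)
  · rintro a ⟨ha, han, he, hf⟩
    have hsq : f a ≤ Nat.sqrt n := by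
      exact_mod_cast Real.nat_floor_real_sqrt_eq_nat_sqrt (a := n) ▸ Nat.le_floor hf
    have h2 : 2 ≤ f a := Nat.le_of_dvd (f_pos ha) (even_f ha he).two_dvd
    have hp := Nat.prime_of_mem_primeFactors (maxPrimeFac_mem ha)
    have hpow : 2 ^ (a.factorization (maxPrimeFac a) - 1) ≤ n := by
      have h1 := Nat.mul_le_mul
        (Nat.pow_le_pow_left hp.two_le (a.factorization (maxPrimeFac a) - 1)) h2
      rw [pow_mul_f] at h1
      lia
    have hlog := Nat.le_log_of_pow_le Nat.one_lt_two hpow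
    simp only [Finset.coe_product, Set.mem_prod, Finset.mem_coe, Finset.mem_Icc, Finset.mem_range]
    lia
  · rintro a ⟨ha, -, hea, -⟩ b ⟨hb, -, heb, -⟩ hab
    obtain ⟨h1, h2⟩ := Prod.mk.inj hab
    have hf : f a = f b := by
      have := (even_f ha hea).two_dvd
      have := (even_f hb heb).two_dvd
      lia
    have hm : maxPrimeFac a = maxPrimeFac b := by
      rw [← maxPrimeFac_f ha, hf, maxPrimeFac_f hb]
    rw [← pow_mul_f a, ← pow_mul_f b, h2, hf, hm]

theorem card_small_f_le (n : ℕ) (hn : 4 ≤ n) :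
    ({a : ℕ | 2 ≤ a ∧ a ≤ 2 * n ∧ Even a ∧ (f a : ℝ) ≤ Real.sqrt n}.ncard : ℝ) ≤
      (1 / 2) * Real.sqrt n * Real.logb 2 (2 * n) := by
  have hn0 : (0 : ℝ) < n := by positivity
  have hsqrt : ((Nat.sqrt n / 2 : ℕ) : ℝ) ≤ 1 / 2 * Real.sqrt n := by
    have h1 : ((Nat.sqrt n / 2 : ℕ) : ℝ) ≤ (Nat.sqrt n : ℝ) / 2 := Nat.cast_div_le
    have h2 := Real.nat_sqrt_le_real_sqrt (a := n)
    linarith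
  have hlog : ((Nat.log 2 n + 1 : ℕ) : ℝ) ≤ Real.logb 2 (2 * n) := by
    rw [Real.logb_mul two_ne_zero hn0.ne', Real.logb_self_eq_one one_lt_two]
    have h := Real.natLog_le_logb n 2
    push_cast at h ⊢
    linarith
  calc _ ≤ (((Nat.sqrt n / 2) * (Nat.log 2 n + 1) : ℕ) : ℝ) := by
        exact_mod_cast ncard_small_f_le_mul n
    _ ≤ _ := by
        rw [Nat.cast_mul]
        gcongr
end
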